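/- arXiv:1910.10366 — 3 statements merged into one kernel-verified Lean document; each statement's English description precedes it below -/
import Mathlib

section
/- Let p be a prime number and A a reduced commutative ring of characteristic p. Then multiplication by p is injective on the ring W(A) of p-typical Witt vectors; that is, for x ∈ W(A), p·x = 0 implies x = 0 (so W(A) is p-torsion-free, even though W(A)/pW(A) is killed by p). -/
/-- If `A` is a reduced commutative ring of characteristic `p`, then
multiplication by `p` is injective on `W(A)`. -/
theorem witt_p_torsion_free
    (p : ℕ) [Fact p.Prime] (A : Type*) [CommRing A] [CharP A p] [IsReduced A] :
    ∀ x : WittVector p A, (p : WittVector p A) * x = 0 → x = 0 := by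
  intro x hx
  ext n
  have h := WittVector.mul_charP_coeff_succ x n
  rw [mul_comm, hx, WittVector.zero_coeff] at h
  rw [WittVector.zero_coeff]
  exact eq_zero_of_pow_eq_zero h.symm
end

section
/- Let p be a prime number and A a perfect commutative ring of characteristic p (i.e., the Frobenius x ↦ x^p is bijective on A). Then for every positive integer n, the truncation map W(A) → W_n(A) induces a ring isomorphism W(A)/p^n W(A) ≅ W_n(A). -/
/-- If `A` is a perfect commutative ring of characteristic `p`, then for every
`n > 0` the truncation map induces a ring isomorphism
`W(A)/pⁿW(A) ≅ Wₙ(A)`. -/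
theorem witt_quotient_pow_p_iso_truncated
    (p : ℕ) [Fact p.Prime] (A : Type*) [CommRing A] [CharP A p]
    (hA : Function.Bijective fun x : A => x ^ p)
    (n : ℕ) (hn : 0 < n) :
    ∃ e : (WittVector p A ⧸ Ideal.span {(p : WittVector p A) ^ n}) ≃+*
        TruncatedWittVector p n A,
      ∀ x : WittVector p A,
        e (Ideal.Quotient.mk (Ideal.span {(p : WittVector p A) ^ n}) x) =
          WittVector.truncate n x := by
  have : PerfectRing A p := ⟨hA⟩
  have hker : Ideal.span {(p : WittVector p A) ^ n} =
      RingHom.ker (WittVector.truncate (p := p) (R := A) n) := by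
    ext x
    rw [WittVector.mem_span_p_pow_iff_le_coeff_eq_zero, WittVector.mem_ker_truncate]
  exact ⟨(Ideal.quotEquivOfEq hker).trans
    (RingHom.quotientKerEquivOfSurjective (WittVector.truncate_surjective p n A)),
    fun _ => rfl⟩
end

section
/- Let p be a prime number, k a perfect field of characteristic p, and W = W(k) the ring of p-typical Witt vectors of k. For each n ≥ 1 let M_n = ⊕_{i=0}^{n-1} W/p^{n-i}W, and let the transition map M_{n+1} → M_n send (x_0, …, x_n) to (x̄_0, …, x̄_{n-1}), where x̄_i is the reduction of x_i modulo p^{n-i}. Then the inverse limit lim_n M_n is isomorphic, as a W-module, to the countable product ∏_{i=0}^∞ W. -/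
/-- The `n`-th module `Mₙ = ⊕_{i=0}^{n-1} W/p^{n-i}W` of the inverse system,
realized as a finite product over `Fin n`. -/
abbrev WittLimit.M (p : ℕ) [Fact p.Prime] (k : Type) [Field k] [CharP k p] (n : ℕ) :
    Type :=
  (i : Fin n) → WittVector p k ⧸ Ideal.span {(p : WittVector p k) ^ (n - i.val)}

/-- The componentwise reduction map
`W/p^{(n+1)-i}W → W/p^{n-i}W`, as a `W`-linear map. -/
noncomputable def WittLimit.reduction (p : ℕ) [Fact p.Prime] (k : Type) [Field k]
    [CharP k p] (n : ℕ) (i : Fin n) :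
    (WittVector p k ⧸ Ideal.span {(p : WittVector p k) ^ (n + 1 - i.val)}) →ₗ[WittVector p k]
      (WittVector p k ⧸ Ideal.span {(p : WittVector p k) ^ (n - i.val)}) :=
  Submodule.mapQ (Ideal.span {(p : WittVector p k) ^ (n + 1 - i.val)})
    (Ideal.span {(p : WittVector p k) ^ (n - i.val)}) LinearMap.id
    (by
      rw [Submodule.comap_id]
      exact Ideal.span_singleton_le_span_singleton.mpr
        (pow_dvd_pow _ (by omega)))

/-- The inverse limit `lim_n Mₙ` along the transition maps
`M_{n+1} → Mₙ, (x_0, …, x_n) ↦ (x̄_0, …, x̄_{n-1})`, realized as the submodule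
of compatible sequences in `Π n, Mₙ`. -/
noncomputable def WittLimit.limit (p : ℕ) [Fact p.Prime] (k : Type) [Field k]
    [CharP k p] :
    Submodule (WittVector p k) ((n : ℕ) → WittLimit.M p k n) where
  carrier := {f | ∀ (n : ℕ) (i : Fin n),
    WittLimit.reduction p k n i (f (n + 1) i.castSucc) = f n i}
  add_mem' := by
    intro a b ha hb n i
    simp only [Pi.add_apply, map_add, ha n i, hb n i]
  zero_mem' := by
    intro n i
    simp only [Pi.zero_apply, map_zero]
  smul_mem' := by
    intro c a ha n i
    simp only [Pi.smul_apply, map_smul, ha n i]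

section AdicComplete

variable {R : Type*} [CommRing R] {a : R}

theorem eq_zero_of_forall_pow_dvd [IsHausdorff (Ideal.span {a}) R] {x : R}
    (h : ∀ m : ℕ, a ^ m ∣ x) : x = 0 := by
  refine IsHausdorff.haus (I := Ideal.span {a}) inferInstance x fun m => ?_
  rw [smul_eq_mul, Ideal.mul_top, Ideal.span_singleton_pow, SModEq.zero,
    Ideal.mem_span_singleton]
  exact h m

theorem pow_dvd_sub_of_forall_pow_dvd_succ_sub {s : ℕ → R}
    (h : ∀ m, a ^ m ∣ s (m + 1) - s m) {m n : ℕ} (hmn : m ≤ n) : a ^ m ∣ s n - s m := by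
  induction n, hmn using Nat.le_induction with
  | base => simp
  | succ n hmn ih =>
    rw [← sub_add_sub_cancel _ (s n)]
    exact dvd_add ((pow_dvd_pow a hmn).trans (h n)) ih

theorem exists_forall_pow_dvd_sub [IsPrecomplete (Ideal.span {a}) R] {s : ℕ → R}
    (h : ∀ m, a ^ m ∣ s (m + 1) - s m) : ∃ L, ∀ m, a ^ m ∣ s m - L := by
  obtain ⟨L, hL⟩ := IsPrecomplete.prec' (I := Ideal.span {a}) s fun {m n} hmn => by
    rw [smul_eq_mul, Ideal.mul_top, Ideal.span_singleton_pow]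
    refine SModEq.symm (SModEq.sub_mem.mpr ?_)
    rw [Ideal.mem_span_singleton]
    exact pow_dvd_sub_of_forall_pow_dvd_succ_sub h hmn
  refine ⟨L, fun m => ?_⟩
  have := hL m
  rwa [smul_eq_mul, Ideal.mul_top, Ideal.span_singleton_pow, SModEq.sub_mem,
    Ideal.mem_span_singleton] at this

end AdicComplete

namespace WittLimit

variable (p : ℕ) [Fact p.Prime] (k : Type) [Field k] [CharP k p]

/-- The diagonal reduction map `∏ᵢ W → limₙ Mₙ`. -/
noncomputable def ofProduct : (ℕ → WittVector p k) →ₗ[WittVector p k] limit p k where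
  toFun g := ⟨fun _ i => Submodule.Quotient.mk (g i), fun _ _ => rfl⟩
  map_add' _ _ := rfl
  map_smul' _ _ := rfl

theorem ofProduct_injective [PerfectRing k p] : Function.Injective (ofProduct p k) := by
  rw [injective_iff_map_eq_zero]
  intro g hg
  funext i
  refine eq_zero_of_forall_pow_dvd (a := (p : WittVector p k)) fun m => ?_
  have h : (Submodule.Quotient.mk (g i) :
      WittVector p k ⧸ Ideal.span {(p : WittVector p k) ^ (i + m + 1 - i)}) = 0 :=
    congrFun (congrFun (congrArg Subtype.val hg) (i + m + 1)) ⟨i, by omega⟩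
  rw [Submodule.Quotient.mk_eq_zero, Ideal.mem_span_singleton] at h
  exact (pow_dvd_pow _ (by omega)).trans h

theorem ofProduct_surjective [PerfectRing k p] : Function.Surjective (ofProduct p k) := by
  rintro ⟨f, hf⟩
  choose r hr using fun n (i : Fin n) => Submodule.Quotient.mk_surjective _ (f n i)
  have hstep (n : ℕ) (i : Fin n) :
      (p : WittVector p k) ^ (n - i.val) ∣ r (n + 1) i.castSucc - r n i := by
    rw [← Ideal.mem_span_singleton, ← Submodule.Quotient.eq, hr n i, ← hf n i, ← hr (n + 1)]
    rfl
  have hlim (i : ℕ) : ∃ L, ∀ m, (p : WittVector p k) ^ m ∣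
      r (i + m + 1) ⟨i, by omega⟩ - L :=
    exists_forall_pow_dvd_sub fun m =>
      (pow_dvd_pow _ (by simp only; omega)).trans (hstep (i + m + 1) ⟨i, by omega⟩)
  choose g hg using hlim
  refine ⟨g, Subtype.ext <| funext fun n => funext fun i => ?_⟩
  change Submodule.Quotient.mk (g i) = f n i
  rw [← hr n i, eq_comm, Submodule.Quotient.eq, Ideal.mem_span_singleton]
  have hstep_i := hstep n i
  obtain ⟨i, hi⟩ := i
  obtain ⟨m, rfl⟩ := Nat.exists_eq_add_of_lt hi
  have hlim_i := hg i (m + 1)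
  rw [← dvd_neg, neg_sub] at hstep_i
  rw [← sub_add_sub_cancel _ (r (i + m + 1 + 1) ⟨i, by omega⟩)]
  exact dvd_add hstep_i ((pow_dvd_pow _ (by simp only; omega)).trans hlim_i)

end WittLimit

/-- The inverse limit `lim_n ⊕_{i=0}^{n-1} W/p^{n-i}W` is isomorphic, as a
`W`-module, to the countable product `∏_{i=0}^∞ W`. -/
theorem witt_limit_iso_product
    (p : ℕ) [Fact p.Prime] (k : Type) [Field k] [CharP k p]
    (hk : Function.Bijective fun x : k => x ^ p) :
    Nonempty ((WittLimit.limit p k) ≃ₗ[WittVector p k] (ℕ → WittVector p k)) := by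
  have : PerfectRing k p := ⟨hk⟩
  exact ⟨(LinearEquiv.ofBijective (WittLimit.ofProduct p k)
    ⟨WittLimit.ofProduct_injective p k, WittLimit.ofProduct_surjective p k⟩).symm⟩
end
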